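/- Uniform Grönwall decay lemma (precise quantitative form of Lemma 6.1): Let τ, γ, M be positive real numbers and T a real number. Let α : ℝ → ℝ be continuous with α(s) ≤ M for all s ≥ T and ∫_t^{t+τ} α(s) ds ≥ γ for every t ≥ T. Let Y : ℝ → ℝ be differentiable and nonnegative on [T,∞) with Y′(t) + α(t)·Y(t) ≤ 0 for all t ≥ T. Then for every t ≥ T, Y(t) ≤ Y(T)·exp(M·τ)·exp(−(γ/τ)·(t − T)); in particular Y(t) → 0 exponentially fast as t → ∞. -/

import Mathlib

open intervalIntegral in
/-- Concatenating `n` windows of length `τ`, each of integral at least `γ`. -/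
theorem natCast_mul_le_integral_of_window_le {α : ℝ → ℝ} {τ γ T : ℝ} (hτ : 0 ≤ τ)
    (hα : Continuous α) (hint : ∀ t, T ≤ t → γ ≤ ∫ s in t..(t + τ), α s) (n : ℕ) :
    n * γ ≤ ∫ s in T..(T + n * τ), α s := by
  induction n with
  | zero => simp
  | succ n ih =>
    have hwindow := hint (T + n * τ) (le_add_of_nonneg_right (by positivity))
    have hadd := integral_add_adjacent_intervals
      (hα.intervalIntegrable (μ := MeasureTheory.volume) T (T + n * τ))
      (hα.intervalIntegrable (T + n * τ) (T + n * τ + τ))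
    rw [show T + ((n + 1 : ℕ) : ℝ) * τ = T + n * τ + τ by push_cast; ring, ← hadd]
    push_cast
    linarith

open intervalIntegral in
/-- A function bounded above whose integrals over windows of length `τ` are at least `γ` has
integrals growing at least linearly with slope `γ / τ`. -/
theorem linear_le_integral_of_window_le {α : ℝ → ℝ} {τ γ M T : ℝ} (hτ : 0 < τ) (hγ : 0 ≤ γ)
    (hM : 0 ≤ M) (hα : Continuous α) (hbdd : ∀ s, T ≤ s → α s ≤ M)
    (hint : ∀ t, T ≤ t → γ ≤ ∫ s in t..(t + τ), α s) {t : ℝ} (ht : T ≤ t) :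
    γ / τ * (t - T) - M * τ ≤ ∫ s in T..t, α s := by
  set n := ⌈(t - T) / τ⌉₊
  have hn : (t - T) / τ ≤ n := Nat.le_ceil _
  have hn' : (n : ℝ) < (t - T) / τ + 1 :=
    Nat.ceil_lt_add_one (div_nonneg (sub_nonneg.2 ht) hτ.le)
  have hle : t ≤ T + n * τ := by
    rw [div_le_iff₀ hτ] at hn
    linarith
  have hlt : T + n * τ - t ≤ τ := by
    have := mul_le_mul_of_nonneg_right hn'.le hτ.le
    rw [add_mul, div_mul_cancel₀ _ hτ.ne'] at this
    linarith
  have htail : ∫ s in t..(T + n * τ), α s ≤ M * τ := calc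
    _ ≤ ∫ _ in t..(T + n * τ), M :=
      integral_mono_on hle (hα.intervalIntegrable _ _) (by simp)
        fun s hs => hbdd s (ht.trans hs.1)
    _ = M * (T + n * τ - t) := by rw [integral_const, smul_eq_mul, mul_comm]
    _ ≤ M * τ := by gcongr
  have hadd := integral_add_adjacent_intervals
    (hα.intervalIntegrable (μ := MeasureTheory.volume) T t)
    (hα.intervalIntegrable t (T + n * τ))
  have hfull := natCast_mul_le_integral_of_window_le hτ.le hα hint n
  have hslope : γ / τ * (t - T) ≤ n * γ := calc
    γ / τ * (t - T) = (t - T) / τ * γ := by ring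
    _ ≤ n * γ := by gcongr
  linarith

/-- Grönwall's inequality for `Y' + α Y ≤ 0`. -/
theorem le_mul_exp_neg_integral_of_deriv_add_mul_nonpos {α Y Y' : ℝ → ℝ} {T : ℝ}
    (hα : Continuous α) (hderiv : ∀ t, T ≤ t → HasDerivAt Y (Y' t) t)
    (hineq : ∀ t, T ≤ t → Y' t + α t * Y t ≤ 0) {t : ℝ} (ht : T ≤ t) :
    Y t ≤ Y T * Real.exp (-∫ s in T..t, α s) := by
  have hd (x : ℝ) (hx : T ≤ x) : HasDerivAt (fun x => Y x * Real.exp (∫ s in T..x, α s))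
      (Y' x * Real.exp (∫ s in T..x, α s) + Y x * (Real.exp (∫ s in T..x, α s) * α x)) x :=
    (hderiv x hx).mul (hα.integral_hasStrictDerivAt T x).hasDerivAt.exp
  have hanti : AntitoneOn (fun x => Y x * Real.exp (∫ s in T..x, α s)) (Set.Ici T) := by
    refine antitoneOn_of_hasDerivWithinAt_nonpos (convex_Ici T)
      (fun x hx => (hd x hx).continuousAt.continuousWithinAt)
      (fun x hx => (hd x (interior_subset hx)).hasDerivWithinAt) fun x hx => ?_
    have := mul_nonpos_of_nonpos_of_nonneg (hineq x (interior_subset hx))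
      (Real.exp_pos (∫ s in T..x, α s)).le
    linarith
  have hle := hanti Set.self_mem_Ici ht ht
  simp only [intervalIntegral.integral_same, Real.exp_zero, mul_one] at hle
  rwa [Real.exp_neg, ← div_eq_mul_inv, le_div_iff₀ (Real.exp_pos _)]

/-- Uniform Grönwall decay lemma (quantitative form of Lemma 6.1). -/
theorem uniform_gronwall_decay
    (τ γ M T : ℝ) (hτ : 0 < τ) (hγ : 0 < γ) (hM : 0 < M)
    (α : ℝ → ℝ) (hα_cont : Continuous α)
    (hα_bdd : ∀ s, T ≤ s → α s ≤ M)
    (hα_int : ∀ t, T ≤ t → γ ≤ ∫ s in t..(t + τ), α s)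
    (Y Y' : ℝ → ℝ)
    (hY_deriv : ∀ t, T ≤ t → HasDerivAt Y (Y' t) t)
    (hY_nonneg : ∀ t, T ≤ t → 0 ≤ Y t)
    (hY_ineq : ∀ t, T ≤ t → Y' t + α t * Y t ≤ 0) :
    (∀ t, T ≤ t →
      Y t ≤ Y T * Real.exp (M * τ) * Real.exp (-(γ / τ) * (t - T)))
    ∧ Filter.Tendsto Y Filter.atTop (nhds 0) := by
  have hbound (t : ℝ) (ht : T ≤ t) :
      Y t ≤ Y T * Real.exp (M * τ) * Real.exp (-(γ / τ) * (t - T)) := calc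
    Y t ≤ Y T * Real.exp (-∫ s in T..t, α s) :=
      le_mul_exp_neg_integral_of_deriv_add_mul_nonpos hα_cont hY_deriv hY_ineq ht
    _ ≤ Y T * Real.exp (M * τ + -(γ / τ) * (t - T)) := by
      have := linear_le_integral_of_window_le hτ hγ.le hM.le hα_cont hα_bdd hα_int ht
      have := hY_nonneg T le_rfl
      gcongr
      linarith
    _ = Y T * Real.exp (M * τ) * Real.exp (-(γ / τ) * (t - T)) := by
      rw [Real.exp_add, mul_assoc]
  refine ⟨hbound, squeeze_zero' ((Filter.eventually_ge_atTop T).mono hY_nonneg)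
    ((Filter.eventually_ge_atTop T).mono hbound) ?_⟩
  have hlim : Filter.Tendsto (fun t => -(γ / τ) * (t - T)) Filter.atTop Filter.atBot :=
    (Filter.tendsto_atTop_add_const_right _ (-T) Filter.tendsto_id).const_mul_atTop_of_neg
      (neg_lt_zero.2 (div_pos hγ hτ))
  simpa using (Real.tendsto_exp_atBot.comp hlim).const_mul (Y T * Real.exp (M * τ))
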